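/- arXiv:quant-ph/0203077 — 4 statements merged into one kernel-verified Lean document; each statement's English description precedes it below -/
import Mathlib

section
/- For every prime d, with q = d², and every δ > 0, there exists n₀ (depending only on q and δ) such that for all n ≥ n₀ and every integer k with n/2 ≤ k ≤ n, there exists an additive code C ⊆ 𝔽_q^n with |C| = q^k and C^⊥ ⊆ C, such that for every type P ≠ P₀ of sequences of length n over 𝔽_q, |C ∩ T_P| ≤ q^{n(k/n + H_q(P) − 1 + δ)}. -/
/-!
STATEMENT 0: Gilbert–Varshamov-type bound for self-orthogonal-containing additive
codes over 𝔽_q = 𝔽_{d²}, identified with (𝔽_d × 𝔽_d)ⁿ.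
-/

open scoped BigOperators

/-- The empirical distribution (type) of a word `x` of length `n` over alphabet `α`. -/
noncomputable def empDist {α : Type*} [DecidableEq α] {n : ℕ} (x : Fin n → α) : α → ℝ :=
  fun u => ((Finset.univ.filter (fun i => x i = u)).card : ℝ) / n

/-- Base-`q` entropy `H_q(P) = -∑ P(u) log_q P(u)` of a distribution on `α`. -/
noncomputable def entropyBase (q : ℕ) {α : Type*} [Fintype α] (P : α → ℝ) : ℝ :=
  -∑ u, P u * Real.logb q (P u)

/-- The standard symplectic form on `(𝔽_d × 𝔽_d)ⁿ`:
`(x,y) = ∑ᵢ (xᵢ yᵢ' − xᵢ' yᵢ)`. -/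
def sympForm {d n : ℕ} (x y : Fin n → ZMod d × ZMod d) : ZMod d :=
  ∑ i, ((x i).1 * (y i).2 - (x i).2 * (y i).1)

section Counting

variable {d n : ℕ}

theorem sympForm_add_left (x y z : Fin n → ZMod d × ZMod d) :
    sympForm (x + y) z = sympForm x z + sympForm y z := by
  simp only [sympForm, ← Finset.sum_add_distrib, Pi.add_apply, Prod.fst_add, Prod.snd_add]
  exact Finset.sum_congr rfl fun i _ => by ring

theorem sympForm_smul_left (a : ZMod d) (x z : Fin n → ZMod d × ZMod d) :
    sympForm (a • x) z = a * sympForm x z := by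
  simp only [sympForm, Finset.mul_sum, Pi.smul_apply, Prod.smul_fst, Prod.smul_snd, smul_eq_mul]
  exact Finset.sum_congr rfl fun i _ => by ring

theorem sympForm_swap (x y : Fin n → ZMod d × ZMod d) : sympForm y x = -sympForm x y := by
  simp only [sympForm, ← Finset.sum_neg_distrib]
  exact Finset.sum_congr rfl fun i _ => by ring

theorem sympForm_self (x : Fin n → ZMod d × ZMod d) : sympForm x x = 0 :=
  Finset.sum_eq_zero fun i _ => by ring

theorem sympForm_add_right (x y z : Fin n → ZMod d × ZMod d) :
    sympForm z (x + y) = sympForm z x + sympForm z y := by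
  rw [sympForm_swap, sympForm_add_left, sympForm_swap z x, sympForm_swap z y, neg_add]; ring

theorem sympForm_smul_right (a : ZMod d) (x z : Fin n → ZMod d × ZMod d) :
    sympForm z (a • x) = a * sympForm z x := by
  rw [sympForm_swap, sympForm_smul_left, sympForm_swap z x]; ring

theorem sympForm_single_right (x : Fin n → ZMod d × ZMod d) (i : Fin n) (a : ZMod d × ZMod d) :
    sympForm x (Pi.single i a) = (x i).1 * a.2 - (x i).2 * a.1 := by
  rw [sympForm, Finset.sum_eq_single i]
  · simp
  · intro j _ hj
    simp [Pi.single_eq_of_ne hj]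
  · simp

theorem exists_sympForm_ne_zero {x : Fin n → ZMod d × ZMod d} (hx : x ≠ 0) :
    ∃ z, sympForm x z ≠ 0 := by
  by_contra! h
  refine hx (funext fun i => Prod.ext ?_ ?_)
  · simpa [sympForm_single_right] using h (Pi.single i (0, 1))
  · simpa [sympForm_single_right] using h (Pi.single i (1, 0))

/-- The group of linear automorphisms preserving the symplectic form. -/
def sympGroup (d n : ℕ) :
    Subgroup ((Fin n → ZMod d × ZMod d) ≃ₗ[ZMod d] (Fin n → ZMod d × ZMod d)) where
  carrier := {g | ∀ x y, sympForm (g x) (g y) = sympForm x y}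
  one_mem' := fun _ _ => rfl
  mul_mem' := fun {a b} ha hb x y => (ha (b x) (b y)).trans (hb x y)
  inv_mem' := fun {a} ha x y => by
    rw [← ha, show a (a⁻¹ x) = x from a.apply_symm_apply x,
      show a (a⁻¹ y) = y from a.apply_symm_apply y]

/-- The symplectic transvection `v ↦ v + a (v, w) w`. -/
def sympTransvection (a : ZMod d) (w : Fin n → ZMod d × ZMod d) :
    (Fin n → ZMod d × ZMod d) ≃ₗ[ZMod d] (Fin n → ZMod d × ZMod d) where
  toFun v := v + (a * sympForm v w) • w
  invFun v := v - (a * sympForm v w) • w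
  left_inv v := by
    simp [sympForm_add_left, sympForm_smul_left, sympForm_self]
  right_inv v := by
    simp only [sub_eq_add_neg, ← neg_smul, sympForm_add_left, sympForm_smul_left, sympForm_self,
      mul_zero, add_zero, add_assoc, ← add_smul, neg_add_cancel, zero_smul]
  map_add' v v' := by
    simp only [sympForm_add_left, mul_add, add_smul]
    abel
  map_smul' b v := by
    rw [sympForm_smul_left, RingHom.id_apply, smul_add, smul_smul, mul_left_comm]

theorem sympTransvection_mem (a : ZMod d) (w : Fin n → ZMod d × ZMod d) :
    sympTransvection a w ∈ sympGroup d n := by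
  intro x y
  change sympForm (x + (a * sympForm x w) • w) (y + (a * sympForm y w) • w) = sympForm x y
  rw [sympForm_add_left, sympForm_add_right, sympForm_add_right, sympForm_smul_left,
    sympForm_smul_left, sympForm_smul_right, sympForm_smul_right, sympForm_self,
    sympForm_swap y w]
  ring

theorem exists_sympGroup_apply_eq_of_sympForm_ne_zero [Fact d.Prime]
    {x y : Fin n → ZMod d × ZMod d} (h : sympForm x y ≠ 0) : ∃ g ∈ sympGroup d n, g x = y := by
  refine ⟨sympTransvection (sympForm x y)⁻¹ (y - x), sympTransvection_mem _ _, ?_⟩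
  change x + ((sympForm x y)⁻¹ * sympForm x (y - x)) • (y - x) = y
  have : sympForm x (y - x) = sympForm x y := by
    have := sympForm_add_right (y - x) x x
    rw [sub_add_cancel, sympForm_self, add_zero] at this
    exact this.symm
  rw [this, inv_mul_cancel₀ h, one_smul]
  abel

theorem exists_sympGroup_apply_eq [Fact d.Prime] {x y : Fin n → ZMod d × ZMod d}
    (hx : x ≠ 0) (hy : y ≠ 0) : ∃ g ∈ sympGroup d n, g x = y := by
  obtain ⟨z, hxz, hyz⟩ : ∃ z, sympForm x z ≠ 0 ∧ sympForm y z ≠ 0 := by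
    obtain ⟨u, hu⟩ := exists_sympForm_ne_zero hx
    obtain ⟨v, hv⟩ := exists_sympForm_ne_zero hy
    by_cases hyu : sympForm y u = 0
    · by_cases hxv : sympForm x v = 0
      · exact ⟨u + v, by simpa [sympForm_add_right, hxv] using hu,
          by simpa [sympForm_add_right, hyu] using hv⟩
      · exact ⟨v, hxv, hv⟩
    · exact ⟨u, hu, hyu⟩
  obtain ⟨g, hg, hgx⟩ := exists_sympGroup_apply_eq_of_sympForm_ne_zero hxz
  obtain ⟨h, hh, hhz⟩ := exists_sympGroup_apply_eq_of_sympForm_ne_zero (x := z) (y := y)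
    (by rw [sympForm_swap]; exact neg_ne_zero.2 hyz)
  exact ⟨h * g, mul_mem hh hg, by rw [LinearEquiv.mul_apply, hgx, hhz]⟩

/-- A group acting on `V` by linear automorphisms, transitively on nonzero vectors, moves a
given nonzero vector into `C` with probability at most `|C| / |V|`. -/
theorem card_filter_apply_mem_mul_le {R V : Type*} [Semiring R]
    [AddCommGroup V] [Module R V] [Fintype V] [DecidableEq V]
    (G : Subgroup (V ≃ₗ[R] V)) [Fintype G]
    (hG : ∀ x y : V, x ≠ 0 → y ≠ 0 → ∃ g ∈ G, g x = y)
    (C : Finset V) (hC : 0 ∈ C) {x : V} (hx : x ≠ 0) :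
    (Finset.univ.filter fun g : G => (g : V ≃ₗ[R] V) x ∈ C).card * Fintype.card V ≤
      Fintype.card G * C.card := by
  set A : V → ℕ := fun c => (Finset.univ.filter fun g : G => (g : V ≃ₗ[R] V) x = c).card with hA
  have hA0 : A 0 = 0 := by
    simp [hA, hx]
  have hAx : ∀ c ≠ 0, A c = A x := by
    intro c hc
    obtain ⟨h, hh, hhc⟩ := hG x c hx hc
    refine (Finset.card_bij (fun g _ => (⟨h, hh⟩ : G) * g) ?_ ?_ ?_).symm
    · intro g hg
      simpa [LinearEquiv.mul_apply, (Finset.mem_filter.1 hg).2] using hhc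
    · intro g _ g' _ hgg
      exact mul_left_cancel hgg
    · intro g hg
      refine ⟨(⟨h, hh⟩ : G)⁻¹ * g, ?_, mul_inv_cancel_left (⟨h, hh⟩ : G) g⟩
      refine Finset.mem_filter.2 ⟨Finset.mem_univ _, ?_⟩
      change h.symm ((g : V ≃ₗ[R] V) x) = x
      rw [(Finset.mem_filter.1 hg).2, ← hhc, h.symm_apply_apply]
  have key : ∀ S : Finset V, 0 ∈ S →
      (Finset.univ.filter fun g : G => (g : V ≃ₗ[R] V) x ∈ S).card = (S.card - 1) * A x := by
    intro S hS
    rw [Finset.card_eq_sum_card_fiberwise (f := fun g : G => (g : V ≃ₗ[R] V) x) (t := S)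
      (s := Finset.univ.filter fun g : G => (g : V ≃ₗ[R] V) x ∈ S)
      (fun g hg => (Finset.mem_filter.1 hg).2), ← Finset.add_sum_erase S _ hS,
      ← Finset.card_erase_of_mem hS, ← smul_eq_mul, ← Finset.sum_const]
    have hfib : ∀ c ∈ S, ((Finset.univ.filter fun g : G => (g : V ≃ₗ[R] V) x ∈ S).filter
        fun g : G => (g : V ≃ₗ[R] V) x = c).card = A c := by
      intro c hc
      rw [hA, Finset.filter_filter]
      congr 1
      ext g
      simp only [Finset.mem_filter, Finset.mem_univ, true_and, and_iff_right_iff_imp]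
      rintro rfl
      exact hc
    rw [hfib 0 hS, hA0, zero_add]
    exact Finset.sum_congr rfl fun c hc =>
      (hfib c (Finset.mem_of_mem_erase hc)).trans (hAx c (Finset.ne_of_mem_erase hc))
  have hGcard : Fintype.card G = (Fintype.card V - 1) * A x := by
    simpa using key Finset.univ (Finset.mem_univ _)
  rw [key C hC, hGcard]
  have h1 : 1 ≤ C.card := Finset.card_pos.2 ⟨0, hC⟩
  have h2 : C.card ≤ Fintype.card V := Finset.card_le_univ C
  obtain ⟨a, ha⟩ := Nat.exists_eq_add_of_le h1
  obtain ⟨b, hb⟩ := Nat.exists_eq_add_of_le (h1.trans h2)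
  have hab := Nat.mul_le_mul_right (A x) (show a ≤ b by omega)
  rw [ha, hb, Nat.add_sub_cancel_left, Nat.add_sub_cancel_left]
  nlinarith

/-- The words whose unprimed coordinates vanish from position `m` on. -/
def coordCode (d n m : ℕ) : AddSubgroup (Fin n → ZMod d × ZMod d) where
  carrier := {x | ∀ i : Fin n, m ≤ i → (x i).1 = 0}
  zero_mem' := fun _ _ => rfl
  add_mem' := fun hx hy i hi => by simp [hx i hi, hy i hi]
  neg_mem' := fun hx i hi => by simp [hx i hi]

theorem card_coordCode [NeZero d] {m : ℕ} (hm : m ≤ n) :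
    Nat.card (coordCode d n m) = d ^ (n + m) := by
  let e : coordCode d n m ≃ (Fin n → ZMod d) × (Fin m → ZMod d) :=
    { toFun x := (fun i => (x.1 i).2, fun i => (x.1 (Fin.castLE hm i)).1)
      invFun p := ⟨fun i => (if h : (i : ℕ) < m then p.2 ⟨i, h⟩ else 0, p.1 i), fun i hi => by
        simp [not_lt.2 hi]⟩
      left_inv x := by
        ext i : 2
        refine Prod.ext ?_ rfl
        by_cases h : (i : ℕ) < m
        · simp [h]
        · simpa [h] using (x.2 i (not_lt.1 h)).symm
      right_inv p := by
        ext i <;> simp }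
  rw [Nat.card_congr e, Nat.card_prod]
  simp [pow_add]

theorem mem_coordCode_of_sympForm_eq_zero {m : ℕ} {y : Fin n → ZMod d × ZMod d}
    (h : ∀ x ∈ coordCode d n m, sympForm x y = 0) : y ∈ coordCode d n m := by
  intro i _
  have hi : Pi.single i (0, 1) ∈ coordCode d n m := by
    intro j _
    by_cases hj : j = i
    · subst hj; simp
    · simp [Pi.single_eq_of_ne hj]
  simpa [sympForm_swap y, sympForm_single_right] using h _ hi

end Counting

section Types

variable {α : Type*} [Fintype α] [DecidableEq α] {n : ℕ}

theorem sum_empDist (hn : n ≠ 0) (x : Fin n → α) : ∑ u, empDist x u = 1 := by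
  simp only [empDist, ← Finset.sum_div]
  rw [← Nat.cast_sum, ← Finset.card_eq_sum_card_fiberwise (fun i _ => Finset.mem_univ (x i))]
  simp [hn]

theorem prod_empDist {q : ℕ} (hq : 1 < q) (x : Fin n → α) :
    ∏ i, empDist x (x i) = (q : ℝ) ^ (-((n : ℝ) * entropyBase q (empDist x))) := by
  rcases Nat.eq_zero_or_pos n with rfl | hn
  · simp
  have hn' : (0 : ℝ) < n := Nat.cast_pos.2 hn
  have hq' : (1 : ℝ) < q := Nat.one_lt_cast.2 hq
  have hpos : ∀ i, 0 < empDist x (x i) := fun i =>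
    div_pos (Nat.cast_pos.2 (Finset.card_pos.2 ⟨i, by simp⟩)) hn'
  have hsum : ∑ i, Real.logb q (empDist x (x i)) =
      -((n : ℝ) * entropyBase q (empDist x)) := by
    rw [← Finset.sum_fiberwise (Finset.univ : Finset (Fin n)) x, entropyBase, mul_neg, neg_neg,
      Finset.mul_sum]
    refine Finset.sum_congr rfl fun u _ => ?_
    rw [Finset.sum_congr rfl (g := fun _ => Real.logb q (empDist x u))
      (fun i hi => by rw [(Finset.mem_filter.1 hi).2]), Finset.sum_const, nsmul_eq_mul,
      ← mul_assoc]
    congr 1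
    rw [empDist, mul_div_cancel₀ _ hn'.ne']
  rw [← hsum, ← Real.logb_prod _ _ fun i _ => (hpos i).ne',
    Real.rpow_logb (by linarith) hq'.ne' (Finset.prod_pos fun i _ => hpos i)]

/-- The number of words of type `P` is at most `q ^ (n H_q(P))`. -/
theorem card_filter_empDist_le {q : ℕ} (hq : 1 < q) (hn : n ≠ 0) (P : α → ℝ)
    [DecidableEq (α → ℝ)] :
    ((Finset.univ.filter fun x : Fin n → α => empDist x = P).card : ℝ) ≤
      (q : ℝ) ^ ((n : ℝ) * entropyBase q P) := by
  have hq' : (0 : ℝ) < q := Nat.cast_pos.2 (by omega)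
  set T := Finset.univ.filter fun x : Fin n → α => empDist x = P with hT
  rcases T.eq_empty_or_nonempty with h | ⟨x₀, hx₀⟩
  · rw [h]
    simpa using (Real.rpow_pos_of_pos hq' _).le
  have hP0 : ∀ u, 0 ≤ P u := fun u => by
    rw [← (Finset.mem_filter.1 hx₀).2]
    exact div_nonneg (Nat.cast_nonneg _) (Nat.cast_nonneg _)
  have hP1 : ∑ u, P u = 1 := by
    rw [← (Finset.mem_filter.1 hx₀).2]
    exact sum_empDist hn x₀
  have h1 : ∑ x ∈ T, ∏ i, P (x i) ≤ 1 := by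
    calc ∑ x ∈ T, ∏ i, P (x i) ≤ ∑ x : Fin n → α, ∏ i, P (x i) :=
          Finset.sum_le_univ_sum_of_nonneg fun x => Finset.prod_nonneg fun i _ => hP0 _
      _ = (∑ u, P u) ^ n := (Fintype.sum_pow P n).symm
      _ = 1 := by rw [hP1, one_pow]
  rw [Finset.sum_congr rfl (g := fun _ => (q : ℝ) ^ (-((n : ℝ) * entropyBase q P)))
    (fun x hx => by
      have hx := (Finset.mem_filter.1 hx).2
      rw [← hx]; exact prod_empDist hq x), Finset.sum_const, nsmul_eq_mul,
    Real.rpow_neg hq'.le, ← div_eq_mul_inv, div_le_one (Real.rpow_pos_of_pos hq' _)] at h1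
  exact h1

theorem card_image_empDist_le [DecidableEq (α → ℝ)] :
    (Finset.univ.image fun x : Fin n → α => empDist x).card ≤ (n + 1) ^ Fintype.card α := by
  let f : (Fin n → α) → (α → Fin (n + 1)) := fun x u =>
    ⟨(Finset.univ.filter fun i => x i = u).card,
      Nat.lt_succ_of_le ((Finset.card_le_univ _).trans_eq (Fintype.card_fin n))⟩
  have : (Finset.univ.image fun x : Fin n → α => empDist x) ⊆
      Finset.univ.image fun (c : α → Fin (n + 1)) (u : α) => ((c u : ℕ) : ℝ) / n := by
    intro P hP
    obtain ⟨x, -, rfl⟩ := Finset.mem_image.1 hP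
    exact Finset.mem_image.2 ⟨f x, Finset.mem_univ _, rfl⟩
  refine (Finset.card_le_card this).trans (Finset.card_image_le.trans ?_)
  simp

end Types

theorem exists_forall_succ_pow_le_rpow {q : ℕ} (hq : 1 < q) {δ : ℝ} (hδ : 0 < δ) :
    ∃ n₀ : ℕ, ∀ n : ℕ, n₀ ≤ n → n ≠ 0 ∧ ((n : ℝ) + 1) ^ q ≤ (q : ℝ) ^ ((n : ℝ) * δ) := by
  have hq' : (1 : ℝ) < q := Nat.one_lt_cast.2 hq
  have hr : 1 < (q : ℝ) ^ δ := Real.one_lt_rpow hq' hδ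
  have h := (isLittleO_pow_const_const_pow_of_one_lt q hr (R := ℝ)).def
    (show (0 : ℝ) < (2 ^ q)⁻¹ by positivity)
  obtain ⟨n₀, hn₀⟩ := Filter.eventually_atTop.1 (h.and (Filter.eventually_ge_atTop 1))
  refine ⟨n₀, fun n hn => ?_⟩
  obtain ⟨h, h1⟩ := hn₀ n hn
  have h1' : (1 : ℝ) ≤ n := Nat.one_le_cast.2 h1
  refine ⟨by omega, ?_⟩
  rw [Real.norm_of_nonneg (by positivity), Real.norm_of_nonneg (by positivity),
    inv_mul_eq_div, le_div_iff₀ (by positivity), ← mul_pow] at h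
  rw [mul_comm, Real.rpow_mul (by positivity), Real.rpow_natCast]
  exact (pow_le_pow_left₀ (by positivity) (by linarith) q).trans h

/-- Averaging over the images of a code under a group acting transitively on nonzero vectors: some
image meets every set of a given finite family `T` of sets of nonzero vectors in at most
`|S| |C| / |V|` times its size. -/
theorem exists_card_filter_apply_mem_le {R V : Type*} [Semiring R] [AddCommGroup V] [Module R V]
    [Fintype V] [DecidableEq V] (G : Subgroup (V ≃ₗ[R] V))
    (hG : ∀ x y : V, x ≠ 0 → y ≠ 0 → ∃ g ∈ G, g x = y) {ι : Type*} (S : Finset ι)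
    (T : ι → Finset V) (hT : ∀ P ∈ S, 0 ∉ T P) (C : Finset V) (hC : 0 ∈ C) :
    ∃ g ∈ G, ∀ P ∈ S, (((T P).filter fun x => g x ∈ C).card : ℝ) ≤
      S.card * (C.card / Fintype.card V) * (T P).card := by
  have : Finite (V ≃ₗ[R] V) :=
    Finite.of_injective (fun g : V ≃ₗ[R] V => (g : V → V)) DFunLike.coe_injective
  let _ : Fintype G := Fintype.ofFinite _
  have hVpos : (0 : ℝ) < Fintype.card V := Nat.cast_pos.2 Fintype.card_pos
  set r : ℝ := C.card / Fintype.card V with hr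
  have hr0 : 0 ≤ r := by positivity
  have havg : ∀ P ∈ S, ∑ g : G,
      (((T P).filter fun x => (g : V ≃ₗ[R] V) x ∈ C).card : ℝ) ≤
        Fintype.card G * r * (T P).card := by
    intro P hP
    have hswap : ∑ g : G, ((T P).filter fun x => (g : V ≃ₗ[R] V) x ∈ C).card =
        ∑ x ∈ T P, (Finset.univ.filter fun g : G => (g : V ≃ₗ[R] V) x ∈ C).card := by
      simp only [Finset.card_filter]
      exact Finset.sum_comm
    rw [← Nat.cast_sum, hswap, Nat.cast_sum, mul_comm, ← nsmul_eq_mul]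
    refine Finset.sum_le_card_nsmul _ _ _ fun x hx => ?_
    have hx0 : x ≠ 0 := fun h => hT P hP (h ▸ hx)
    rw [hr, ← mul_div_assoc, le_div_iff₀ hVpos]
    exact_mod_cast card_filter_apply_mem_mul_le G hG C hC hx0
  obtain ⟨g, -, hg⟩ := Finset.exists_le_of_sum_le
    (s := (Finset.univ : Finset G))
    (f := fun g : G => ∑ P ∈ S, (((T P).filter fun x => (g : V ≃ₗ[R] V) x ∈ C).card : ℝ) / (T P).card)
    (g := fun _ => S.card * r) Finset.univ_nonempty (by
      rw [Finset.sum_comm, Finset.sum_const, nsmul_eq_mul, Finset.card_univ, mul_left_comm,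
        ← nsmul_eq_mul]
      refine Finset.sum_le_card_nsmul _ _ _ fun P hP => ?_
      rw [← Finset.sum_div]
      exact div_le_of_le_mul₀ (Nat.cast_nonneg _) (by positivity) (havg P hP))
  refine ⟨g, g.2, fun P hP => ?_⟩
  rcases (T P).eq_empty_or_nonempty with h | h
  · simp [h]
  rw [← div_le_iff₀ (Nat.cast_pos.2 h.card_pos)]
  exact (Finset.single_le_sum (f := fun P =>
    (((T P).filter fun x => (g : V ≃ₗ[R] V) x ∈ C).card : ℝ) / (T P).card)
    (fun P _ => by positivity) hP).trans hg

theorem gv_bound_additive_codes (d : ℕ) [Fact d.Prime] (q : ℕ) (hq : q = d ^ 2)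
    (δ : ℝ) (hδ : 0 < δ) :
    ∃ n₀ : ℕ, ∀ n : ℕ, n₀ ≤ n → ∀ k : ℕ, n ≤ 2 * k → k ≤ n →
      ∃ C : AddSubgroup (Fin n → ZMod d × ZMod d),
        Nat.card C = q ^ k ∧
        (∀ y : Fin n → ZMod d × ZMod d, (∀ x ∈ C, sympForm x y = 0) → y ∈ C) ∧
        (∀ P : ZMod d × ZMod d → ℝ,
          (∃ x : Fin n → ZMod d × ZMod d, empDist x = P) →
          P ≠ empDist (0 : Fin n → ZMod d × ZMod d) →
          (Nat.card {x : Fin n → ZMod d × ZMod d // x ∈ C ∧ empDist x = P} : ℝ) ≤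
            (q : ℝ) ^ ((n : ℝ) * ((k : ℝ) / n + entropyBase q P - 1 + δ))) := by
  classical
  have hd : 1 < d := (Fact.out : d.Prime).one_lt
  have hq1 : 1 < q := hq ▸ Nat.one_lt_pow two_ne_zero hd
  have hq0 : (0 : ℝ) < q := Nat.cast_pos.2 (by omega)
  obtain ⟨n₀, hn₀⟩ := exists_forall_succ_pow_le_rpow hq1 hδ
  refine ⟨n₀, fun n hn k hk hkn => ?_⟩
  obtain ⟨hn0, hpow⟩ := hn₀ n hn
  set V := Fin n → ZMod d × ZMod d
  have hn0' : (n : ℝ) ≠ 0 := Nat.cast_ne_zero.2 hn0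
  have hcardα : Fintype.card (ZMod d × ZMod d) = q := by simp [hq, sq]
  have hcardV : Fintype.card V = q ^ n := by
    simp [V, hq, sq]
  set C₀ := coordCode d n (2 * k - n) with hC₀
  have hC₀card : Nat.card C₀ = q ^ k := by
    rw [hC₀, card_coordCode (by omega), hq, ← pow_mul]
    congr 1
    omega
  set S : Finset (ZMod d × ZMod d → ℝ) :=
    (Finset.univ.image fun x : V => empDist x).erase (empDist (0 : V))
  have hScard : (S.card : ℝ) ≤ (n + 1 : ℝ) ^ q := by
    have := (Finset.card_erase_le (s := Finset.univ.image fun x : V => empDist x)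
      (a := empDist (0 : V))).trans card_image_empDist_le
    rw [hcardα] at this
    exact_mod_cast this
  obtain ⟨g, hg, hgle⟩ := exists_card_filter_apply_mem_le (sympGroup d n)
    (fun _ _ => exists_sympGroup_apply_eq) S
    (fun P => Finset.univ.filter fun x : V => empDist x = P)
    (fun P hP h0 => (Finset.mem_erase.1 hP).1 (Finset.mem_filter.1 h0).2.symm)
    (Finset.univ.filter fun x : V => x ∈ C₀) (by simp)
  refine ⟨C₀.comap (g : V →ₗ[ZMod d] V).toAddMonoidHom, ?_, ?_, ?_⟩
  · rw [← hC₀card]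
    exact Nat.card_congr (g.toEquiv.subtypeEquiv fun x => Iff.rfl)
  · intro y hy
    refine mem_coordCode_of_sympForm_eq_zero (y := g y) fun x hx => ?_
    have hx' : g (g⁻¹ x) = x := g.apply_symm_apply x
    rw [← hx', hg]
    refine hy _ ?_
    change g (g⁻¹ x) ∈ C₀
    rwa [hx']
  · rintro P ⟨x, hx⟩ hP
    have hPS : P ∈ S := Finset.mem_erase.2 ⟨hP, Finset.mem_image.2 ⟨x, Finset.mem_univ _, hx⟩⟩
    have hfin : Nat.card {x : V //
        x ∈ C₀.comap (g : V →ₗ[ZMod d] V).toAddMonoidHom ∧ empDist x = P} =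
        ((Finset.univ.filter fun x : V => empDist x = P).filter fun x =>
          g x ∈ Finset.univ.filter fun x : V => x ∈ C₀).card := by
      rw [Nat.card_eq_fintype_card, Fintype.card_subtype, Finset.filter_filter]
      congr 1
      ext x
      simp [and_comm]
    have hCcard : ((Finset.univ.filter fun x : V => x ∈ C₀).card : ℝ) = (q : ℝ) ^ (k : ℝ) := by
      rw [Real.rpow_natCast, ← Nat.cast_pow, ← hC₀card, Nat.card_eq_fintype_card,
        Fintype.card_subtype]
    have hexp : (n : ℝ) * ((k : ℝ) / n + entropyBase q P - 1 + δ) =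
        n * δ + (k - n) + n * entropyBase q P := by
      field_simp
      ring
    have h := hgle P hPS
    rw [hCcard, hcardV, Nat.cast_pow, ← Real.rpow_natCast (q : ℝ) n, ← Real.rpow_sub hq0] at h
    rw [hfin, hexp, Real.rpow_add hq0, Real.rpow_add hq0]
    refine h.trans ?_
    gcongr
    · exact hScard.trans hpow
    · exact card_filter_empDist_le hq1 hn0 P
end

section
/- Let G be a finite abelian group, W a probability distribution on G, and W^n the product distribution on G^n given by W^n(y) = Π_{i=1}^n W(y_i). Let C be a subgroup of G^n and let E ⊆ G^n be a set containing, from each coset of C in G^n, exactly one element of maximal W^n-probability within that coset. Then Σ_{e ∈ G^n \ E} W^n(e) ≤ Σ_{x ∈ C, x ≠ 0} Σ_{y ∈ G^n : W^n(y−x) ≥ W^n(y)} W^n(y) ≤ Σ_{x ∈ C, x ≠ 0} Σ_{y ∈ G^n} √(W^n(y)·W^n(y−x)). -/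
/-!
STATEMENT 4: for a subgroup `C ≤ Gⁿ` and a set `E` of coset representatives of
maximal probability, the total probability outside `E` is bounded by the union
bound and then by the Bhattacharyya bound.
-/

open scoped BigOperators Classical

theorem coset_leader_union_bhattacharyya
    (G : Type) [AddCommGroup G] [Fintype G]
    (W : G → ℝ) (hW0 : ∀ x, 0 ≤ W x) (hW1 : ∑ x, W x = 1)
    (n : ℕ) (C : AddSubgroup (Fin n → G)) (E : Finset (Fin n → G))
    (hrep : ∀ y : Fin n → G, ∃! e, e ∈ E ∧ y - e ∈ C)
    (hmax : ∀ e ∈ E, ∀ y : Fin n → G, y - e ∈ C → (∏ i, W (y i)) ≤ ∏ i, W (e i)) :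
    (∑ e ∈ Finset.univ.filter (fun e : Fin n → G => e ∉ E), ∏ i, W (e i)) ≤
      (∑ x ∈ Finset.univ.filter (fun x : Fin n → G => x ∈ C ∧ x ≠ 0),
        ∑ y ∈ Finset.univ.filter
            (fun y : Fin n → G => (∏ i, W (y i)) ≤ ∏ i, W (y i - x i)),
          ∏ i, W (y i)) ∧
    (∑ x ∈ Finset.univ.filter (fun x : Fin n → G => x ∈ C ∧ x ≠ 0),
        ∑ y ∈ Finset.univ.filter
            (fun y : Fin n → G => (∏ i, W (y i)) ≤ ∏ i, W (y i - x i)),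
          ∏ i, W (y i)) ≤
      ∑ x ∈ Finset.univ.filter (fun x : Fin n → G => x ∈ C ∧ x ≠ 0),
        ∑ y : Fin n → G, Real.sqrt ((∏ i, W (y i)) * ∏ i, W (y i - x i)) := by
  have hP : ∀ y : Fin n → G, 0 ≤ ∏ i, W (y i) := fun y =>
    Finset.prod_nonneg fun i _ => hW0 (y i)
  refine ⟨?_, Finset.sum_le_sum fun x _ => ?_⟩
  · rw [Finset.sum_congr rfl fun x _ => Finset.sum_filter _ _, Finset.sum_comm]
    have hterm : ∀ x y : Fin n → G,
        0 ≤ if (∏ i, W (y i)) ≤ ∏ i, W (y i - x i) then ∏ i, W (y i) else 0 :=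
      fun x y => ite_nonneg (hP y) le_rfl
    refine (Finset.sum_le_sum fun y hy => ?_).trans
      (Finset.sum_le_sum_of_subset_of_nonneg (Finset.filter_subset _ _)
        fun y _ _ => Finset.sum_nonneg fun x _ => hterm x y)
    obtain ⟨e, ⟨heE, heC⟩, -⟩ := hrep y
    have hyE : y ∉ E := (Finset.mem_filter.mp hy).2
    have hne : y - e ≠ 0 := fun h => hyE (sub_eq_zero.mp h ▸ heE)
    have hle : (∏ i, W (y i)) ≤ ∏ i, W (y i - (y - e) i) := by
      simpa using hmax e heE y heC
    calc (∏ i, W (y i))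
        = if (∏ i, W (y i)) ≤ ∏ i, W (y i - (y - e) i) then ∏ i, W (y i) else 0 :=
          (if_pos hle).symm
      _ ≤ _ := Finset.single_le_sum
          (f := fun x : Fin n → G =>
            if (∏ i, W (y i)) ≤ ∏ i, W (y i - x i) then ∏ i, W (y i) else 0)
          (fun x _ => hterm x y)
          (Finset.mem_filter.mpr ⟨Finset.mem_univ _, heC, hne⟩)
  · refine (Finset.sum_le_sum fun y hy => ?_).trans
      (Finset.sum_le_sum_of_subset_of_nonneg (Finset.filter_subset _ _)
        fun y _ _ => Real.sqrt_nonneg _)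
    refine Real.le_sqrt_of_sq_le ?_
    rw [sq]
    exact mul_le_mul_of_nonneg_left (Finset.mem_filter.mp hy).2 (hP y)
end

section
/- Let G be a finite abelian group of order q ≥ 2 and W a probability distribution on G; set B_a = Σ_{e∈G} √(W(e)·W(e−a)) for a ∈ G. Let C be a subgroup of G^n and suppose that for real numbers r and δ one has |C ∩ T_P| ≤ q^{n(r + H_q(P) − 1 + δ)} for every type P ≠ P₀ of sequences of length n over G. Then Σ_{x ∈ C, x ≠ 0} Σ_{y ∈ G^n} √(W^n(y)·W^n(y−x)) ≤ Σ_{P type, P ≠ P₀} q^{n(r + H_q(P) − 1 + δ)} · Π_{a∈G} B_a^{n·P(a)}, the sum being over all types P ≠ P₀ of sequences of length n over G. -/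
/-!
STATEMENT 6: bounding the Bhattacharyya sum of a subgroup code by a sum over types,
using a distance-distribution (weight-distribution) hypothesis.
-/

open scoped BigOperators Classical

theorem natCast_mul_empDist {α : Type*} [DecidableEq α] {n : ℕ} (x : Fin n → α) (u : α) :
    (n : ℝ) * empDist x u = (Finset.univ.filter (fun i => x i = u)).card := by
  rcases Nat.eq_zero_or_pos n with rfl | hn
  · simp
  · have : (n : ℝ) ≠ 0 := by positivity
    unfold empDist
    field_simp

theorem empDist_eq_empDist_zero_iff {G : Type*} [Zero G] [DecidableEq G] {n : ℕ}
    (x : Fin n → G) : empDist x = empDist (0 : Fin n → G) ↔ x = 0 := by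
  refine ⟨fun h => ?_, fun h => by rw [h]⟩
  have h0 := natCast_mul_empDist x 0
  rw [h, natCast_mul_empDist, Nat.cast_inj] at h0
  have hcard : (Finset.univ.filter (fun i => x i = 0)).card =
      (Finset.univ : Finset (Fin n)).card := by
    simpa using h0.symm
  funext i
  exact Finset.card_filter_eq_iff.mp hcard i (Finset.mem_univ i)

theorem prod_comp_eq_prod_rpow_empDist {α : Type*} [Fintype α] [DecidableEq α] {n : ℕ}
    (B : α → ℝ) (x : Fin n → α) :
    ∏ i, B (x i) = ∏ a, B a ^ ((n : ℝ) * empDist x a) := by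
  simp_rw [natCast_mul_empDist, Real.rpow_natCast]
  exact (Finset.prod_fiberwise' Finset.univ x B).symm.trans (by simp)

/-- The Bhattacharyya coefficient of a product distribution and its translate factorizes. -/
theorem sum_sqrt_prod_mul_prod_sub {G : Type*} [AddCommGroup G] [Fintype G]
    {W : G → ℝ} (hW : ∀ x, 0 ≤ W x) {n : ℕ} (x : Fin n → G) :
    ∑ y : Fin n → G, Real.sqrt ((∏ i, W (y i)) * ∏ i, W (y i - x i)) =
      ∏ i, ∑ e, Real.sqrt (W e * W (e - x i)) := by
  rw [Finset.prod_univ_sum, Fintype.piFinset_univ]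
  refine Finset.sum_congr rfl fun y _ => ?_
  rw [← Finset.prod_mul_distrib,
    Real.sqrt_prod _ fun i _ => mul_nonneg (hW _) (hW _)]

theorem bhattacharyya_sum_over_types
    (G : Type) [AddCommGroup G] [Fintype G] [DecidableEq G]
    (q : ℕ) (hq : Fintype.card G = q) (hq2 : 2 ≤ q)
    (W : G → ℝ) (hW0 : ∀ x, 0 ≤ W x) (hW1 : ∑ x, W x = 1)
    (n : ℕ) (C : AddSubgroup (Fin n → G)) (r δ : ℝ)
    (hC : ∀ P : G → ℝ, (∃ x : Fin n → G, empDist x = P) →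
      P ≠ empDist (0 : Fin n → G) →
      (Nat.card {x : Fin n → G // x ∈ C ∧ empDist x = P} : ℝ) ≤
        (q : ℝ) ^ ((n : ℝ) * (r + entropyBase q P - 1 + δ))) :
    ∑ x ∈ Finset.univ.filter (fun x : Fin n → G => x ∈ C ∧ x ≠ 0),
        ∑ y : Fin n → G, Real.sqrt ((∏ i, W (y i)) * ∏ i, W (y i - x i)) ≤
      ∑ P ∈ (Finset.univ.image (fun x : Fin n → G => empDist x)).erase
          (empDist (0 : Fin n → G)),
        (q : ℝ) ^ ((n : ℝ) * (r + entropyBase q P - 1 + δ)) *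
          ∏ a : G, (∑ e, Real.sqrt (W e * W (e - a))) ^ ((n : ℝ) * P a) := by
  simp_rw [sum_sqrt_prod_mul_prod_sub hW0]
  rw [← Finset.sum_fiberwise_of_maps_to (g := fun x : Fin n → G => empDist x)
    (t := (Finset.univ.image (fun x : Fin n → G => empDist x)).erase (empDist (0 : Fin n → G)))
    fun x hx => by
      simp only [Finset.mem_filter] at hx
      simp [empDist_eq_empDist_zero_iff, hx.2.2]]
  refine Finset.sum_le_sum fun P hP => ?_
  obtain ⟨hP0, hP⟩ := Finset.mem_erase.mp hP
  obtain ⟨z, -, hz⟩ := Finset.mem_image.mp hP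
  rw [Finset.sum_congr rfl fun x hx => (by
    rw [prod_comp_eq_prod_rpow_empDist (fun a => ∑ e, Real.sqrt (W e * W (e - a))) x,
      (Finset.mem_filter.mp hx).2] :
    ∏ i, ∑ e, Real.sqrt (W e * W (e - x i)) =
      ∏ a : G, (∑ e, Real.sqrt (W e * W (e - a))) ^ ((n : ℝ) * P a)),
    Finset.sum_const, nsmul_eq_mul]
  refine mul_le_mul_of_nonneg_right (le_trans ?_ (hC P ⟨z, hz⟩ hP0)) (by positivity)
  rw [Nat.card_eq_fintype_card, Fintype.card_subtype, Nat.cast_le, Finset.filter_filter]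
  exact Finset.card_le_card <| Finset.monotone_filter_right _ fun x _ hx => ⟨hx.1.1, hx.2⟩
end

section
/- Let G = ℤ/3 × ℤ/3 and let W be the probability distribution on G given by W(0,1) = 0.49, W(2,0) = 0.49, W(1,0) = 0.01, W(1,1) = 0.01, and W(u) = 0 for all other u ∈ G. For ρ = 3/2, the symmetric 9×9 real matrix M indexed by G×G with entries M(x,x') = (Σ_{e∈G} √(W(x−e)·W(x'−e)))^{1/ρ} is not positive semidefinite; that is, there exists a real vector v indexed by G with vᵀMv < 0. -/
/-!
STATEMENT 16: the explicit additive channel on `ℤ/3 × ℤ/3` with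
`W(0,1) = W(2,0) = 0.49`, `W(1,0) = W(1,1) = 0.01` (and `0` elsewhere) is not
nonnegative definite at `ρ = 3/2`: its Bhattacharyya matrix
`M(x,x') = (∑_e √(W(x−e)W(x'−e)))^{1/ρ}` is not positive semidefinite.
-/

open scoped BigOperators

/-- The distribution on `ℤ/3 × ℤ/3` from the paper's example. -/
noncomputable def Wex : ZMod 3 × ZMod 3 → ℝ := fun u =>
  if u = (0, 1) then 0.49
  else if u = (2, 0) then 0.49
  else if u = (1, 0) then 0.01
  else if u = (1, 1) then 0.01
  else 0

/-- The pointwise square root of `Wex`. -/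
noncomputable def sqrtWex : ZMod 3 × ZMod 3 → ℝ := fun u =>
  if u = (0, 1) then 0.7
  else if u = (2, 0) then 0.7
  else if u = (1, 0) then 0.1
  else if u = (1, 1) then 0.1
  else 0

lemma Wex_eq_sqrtWex_sq (u : ZMod 3 × ZMod 3) : Wex u = sqrtWex u ^ 2 := by
  unfold Wex sqrtWex
  split_ifs <;> norm_num

lemma sqrtWex_nonneg (u : ZMod 3 × ZMod 3) : 0 ≤ sqrtWex u := by
  unfold sqrtWex
  split_ifs <;> norm_num

/-- The autocorrelation of `sqrtWex`. -/
noncomputable def autocorrWex : ZMod 3 × ZMod 3 → ℝ := fun d =>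
  if d = (0, 0) then 1
  else if d = (0, 1) ∨ d = (0, 2) then 0.01
  else if d = (1, 1) ∨ d = (2, 2) then 0.49
  else 0.14

lemma sum_sqrtWex_add_mul (d : ZMod 3 × ZMod 3) :
    ∑ e, sqrtWex (d + e) * sqrtWex e = autocorrWex d := by
  have univ_eq : (Finset.univ : Finset (ZMod 3)) = {0, 1, 2} := by decide
  have h (d : ZMod 3 × ZMod 3) : ∑ e, sqrtWex (d + e) * sqrtWex e =
      sqrtWex (d + (0, 1)) * 0.7 + sqrtWex (d + (2, 0)) * 0.7 +
        sqrtWex (d + (1, 0)) * 0.1 + sqrtWex (d + (1, 1)) * 0.1 := by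
    rw [Fintype.sum_prod_type]
    simp +decide [univ_eq, sqrtWex]
    ring
  rw [h]
  revert d
  rintro ⟨a, b⟩
  fin_cases a <;> fin_cases b <;> simp +decide [sqrtWex, autocorrWex] <;> norm_num

lemma sum_sqrt_Wex_mul (x x' : ZMod 3 × ZMod 3) :
    ∑ e, √(Wex (x - e) * Wex (x' - e)) = autocorrWex (x - x') := by
  rw [← sum_sqrtWex_add_mul, ← (Equiv.subLeft x').sum_comp]
  refine Finset.sum_congr rfl fun e _ => ?_
  rw [Wex_eq_sqrtWex_sq, Wex_eq_sqrtWex_sq, ← mul_pow,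
    Real.sqrt_sq (mul_nonneg (sqrtWex_nonneg _) (sqrtWex_nonneg _))]
  simp only [Equiv.subLeft_apply, sub_sub_cancel, sub_sub_eq_add_sub, add_sub_right_comm]

lemma Real.le_rpow_two_thirds {a b : ℝ} (ha : 0 ≤ a) (h : b ^ 3 ≤ a ^ 2) :
    b ≤ a ^ (2 / 3 : ℝ) := by
  refine le_of_pow_le_pow_left₀ three_ne_zero (by positivity) (h.trans_eq ?_)
  rw [← Real.rpow_mul_natCast ha, ← Real.rpow_natCast]
  norm_num

lemma Real.rpow_two_thirds_le {a b : ℝ} (ha : 0 ≤ a) (hb : 0 ≤ b) (h : a ^ 2 ≤ b ^ 3) :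
    a ^ (2 / 3 : ℝ) ≤ b := by
  refine le_of_pow_le_pow_left₀ three_ne_zero hb (Eq.trans_le ?_ h)
  rw [← Real.rpow_mul_natCast ha, ← Real.rpow_natCast]
  norm_num

theorem example_channel_not_nonnegative_definite :
    ∃ v : ZMod 3 × ZMod 3 → ℝ,
      ∑ x : ZMod 3 × ZMod 3, ∑ x' : ZMod 3 × ZMod 3,
        v x *
          ((∑ e : ZMod 3 × ZMod 3, Real.sqrt (Wex (x - e) * Wex (x' - e))) ^
            (1 / (3 / 2 : ℝ))) * v x' < 0 := by
  have univ_eq : (Finset.univ : Finset (ZMod 3)) = {0, 1, 2} := by decide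
  have h49 : (0.62 : ℝ) ≤ 0.49 ^ (2 / 3 : ℝ) :=
    Real.le_rpow_two_thirds (by norm_num) (by norm_num)
  have h14 : (0.269 : ℝ) ≤ 0.14 ^ (2 / 3 : ℝ) :=
    Real.le_rpow_two_thirds (by norm_num) (by norm_num)
  have h01 : (0.01 : ℝ) ^ (2 / 3 : ℝ) ≤ 0.047 :=
    Real.rpow_two_thirds_le (by norm_num) (by norm_num) (by norm_num)
  refine ⟨fun x => if x.1 = 0 then 1 else if x.1 = 1 then -1 else 0, ?_⟩
  simp only [sum_sqrt_Wex_mul, one_div_div]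
  simp only [Fintype.sum_prod_type, univ_eq]
  simp +decide only [autocorrWex, Finset.sum_insert, Finset.sum_singleton, Finset.mem_insert,
    Finset.mem_singleton, if_true, if_false, Real.one_rpow, Prod.mk_sub_mk]
  linarith
end
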